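/- Let G be a finite group and α a normalized 2-cocycle on G with values in ℂˣ, all of whose values are roots of unity. Let π and γ be α-projective representations of G on nonzero finite-dimensional complex vector spaces V_π and V_γ, and let γ* denote the dual map on the dual space V_γ*, given by γ*(g)(φ) = φ ∘ γ(g)⁻¹. If for some h ∈ G the operator π(h) ⊗ γ*(h) is the identity of V_π ⊗ V_γ*, then π(h) and γ(h) are both scalar multiples of the identity, and the ratios of character values satisfy χ_π(h)/χ_π(1) = χ_γ(h)/χ_γ(1), this common value being a root of unity. -/

import Mathlib

/-- If `f ⊗ g` is the identity of a tensor product of nonzero vector spaces, then `f` and `g` are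
mutually inverse scalars. -/
theorem TensorProduct.exists_eq_smul_one_of_map_eq_id {K M N : Type*} [Field K]
    [AddCommGroup M] [Module K M] [Nontrivial M] [AddCommGroup N] [Module K N] [Nontrivial N]
    {f : Module.End K M} {g : Module.End K N}
    (hfg : TensorProduct.map f g = LinearMap.id) :
    ∃ c : Kˣ, f = (c : K) • (1 : Module.End K M) ∧ g = ((c⁻¹ : Kˣ) : K) • (1 : Module.End K N) := by
  have key (m : M) (n : N) : f m ⊗ₜ[K] g n = m ⊗ₜ[K] n := by
    simpa using LinearMap.congr_fun hfg (m ⊗ₜ[K] n)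
  obtain ⟨m, hm⟩ := exists_ne (0 : M)
  obtain ⟨n, hn⟩ := exists_ne (0 : N)
  obtain ⟨φ, hφ⟩ := Module.Projective.exists_dual_ne_zero K hm
  obtain ⟨ψ, hψ⟩ := Module.Projective.exists_dual_ne_zero K hn
  have hf (x : M) : ψ (g n) • f x = ψ n • x := by
    simpa using congrArg (TensorProduct.rid K M ∘ LinearMap.lTensor M ψ) (key x n)
  have hg (y : N) : φ (f m) • g y = φ m • y := by
    simpa using congrArg (TensorProduct.lid K N ∘ LinearMap.rTensor N φ) (key m y)
  have ha : ψ (g n) ≠ 0 := fun h0 => smul_ne_zero hψ hm (by rw [← hf m, h0, zero_smul])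
  have hf' (x : M) : f x = (ψ n / ψ (g n)) • x := by
    rw [div_eq_inv_mul, mul_smul, ← hf x, inv_smul_smul₀ ha]
  have hc : ψ n / ψ (g n) ≠ 0 := div_ne_zero hψ ha
  refine ⟨Units.mk0 _ hc, LinearMap.ext hf', LinearMap.ext fun y => ?_⟩
  have hy := hg y
  rw [hf' m, map_smul, smul_eq_mul, mul_comm, mul_smul] at hy
  have hy' := smul_right_injective N hφ hy
  simp only [Units.val_inv_eq_inv_val, Units.val_mk0, LinearMap.smul_apply, Module.End.one_apply]
  exact (eq_inv_smul_iff₀ hc).2 hy'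

/-- For a projective representation whose cocycle takes values in roots of unity, `π (g ^ k)` is
a root of unity times `π g ^ k`. -/
theorem exists_isOfFinOrder_smul_pow {G K A : Type*} [Monoid G] [Field K] [Ring A] [Algebra K A]
    {α : G → G → Kˣ} (hα : ∀ g h, IsOfFinOrder (α g h)) {π : G → A} (hπ1 : π 1 = 1)
    (hπmul : ∀ g h, π (g * h) = (α g h : K) • (π g * π h)) (g : G) (k : ℕ) :
    ∃ b : Kˣ, IsOfFinOrder b ∧ π (g ^ k) = (b : K) • π g ^ k := by
  induction k with
  | zero => exact ⟨1, IsOfFinOrder.one, by simp [hπ1]⟩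
  | succ k ih =>
    obtain ⟨b, hb, hk⟩ := ih
    refine ⟨α (g ^ k) g * b, (hα _ _).mul hb, ?_⟩
    rw [pow_succ, hπmul, hk, smul_mul_assoc, smul_smul, ← pow_succ, Units.val_mul]


/-- Let `G` be a finite group and `α` a normalized 2-cocycle on `G`
with values in `ℂˣ`, all of whose values are roots of unity.  Let `π`, `γ` be
`α`-projective representations of `G` on nonzero finite-dimensional complex vector
spaces `V`, `W`, and let `γ*` be the dual map on the dual space, `γ* g φ = φ ∘ (γ g)⁻¹`.
If for some `h ∈ G` the operator `π h ⊗ γ* h` is the identity of `V ⊗ W*`, then `π h`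
and `γ h` are both scalar multiples of the identity, and
`χ_π h / χ_π 1 = χ_γ h / χ_γ 1`, this common value being a root of unity. -/
theorem stmt8
    {G : Type*} [Group G] [Finite G]
    {V W : Type*} [AddCommGroup V] [Module ℂ V] [FiniteDimensional ℂ V] [Nontrivial V]
    [AddCommGroup W] [Module ℂ W] [FiniteDimensional ℂ W] [Nontrivial W]
    (α : G → G → ℂˣ)
    (hcoc : ∀ g h t : G, α g h * α (g * h) t = α g (h * t) * α h t)
    (hnorm₁ : ∀ g : G, α g 1 = 1) (hnorm₂ : ∀ g : G, α 1 g = 1)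
    (hroot : ∀ g h : G, ∃ n : ℕ, 0 < n ∧ (α g h) ^ n = 1)
    (π : G → Module.End ℂ V)
    (hπunit : ∀ g : G, IsUnit (π g))
    (hπ1 : π 1 = 1)
    (hπmul : ∀ g h : G, π (g * h) = (α g h : ℂ) • (π g * π h))
    (γ : G → Module.End ℂ W)
    (hγunit : ∀ g : G, IsUnit (γ g))
    (hγ1 : γ 1 = 1)
    (hγmul : ∀ g h : G, γ (g * h) = (α g h : ℂ) • (γ g * γ h))
    (h : G)
    (hid : TensorProduct.map (π h) (LinearMap.dualMap (Ring.inverse (γ h))) =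
      (LinearMap.id :
        TensorProduct ℂ V (Module.Dual ℂ W) →ₗ[ℂ] TensorProduct ℂ V (Module.Dual ℂ W))) :
    (∃ c : ℂˣ, π h = (c : ℂ) • (1 : Module.End ℂ V)) ∧
    (∃ d : ℂˣ, γ h = (d : ℂ) • (1 : Module.End ℂ W)) ∧
    LinearMap.trace ℂ V (π h) / LinearMap.trace ℂ V (π 1) =
      LinearMap.trace ℂ W (γ h) / LinearMap.trace ℂ W (γ 1) ∧
    ∃ n : ℕ, 0 < n ∧
      (LinearMap.trace ℂ V (π h) / LinearMap.trace ℂ V (π 1)) ^ n = 1 := by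
  obtain ⟨c, hπc, hγc⟩ := TensorProduct.exists_eq_smul_one_of_map_eq_id hid
  have hinv : Ring.inverse (γ h) = ((c⁻¹ : ℂˣ) : ℂ) • (1 : Module.End ℂ W) := by
    ext w
    rw [← sub_eq_zero, ← Module.forall_dual_apply_eq_zero_iff ℂ]
    intro φ
    have hφ := LinearMap.congr_fun (LinearMap.congr_fun hγc φ) w
    simp only [LinearMap.dualMap_apply, LinearMap.smul_apply, Module.End.one_apply] at hφ
    rw [map_sub, hφ, LinearMap.smul_apply, Module.End.one_apply, map_smul, sub_self]
  have hγd : γ h = (c : ℂ) • (1 : Module.End ℂ W) := by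
    have h1 := Ring.mul_inverse_cancel _ (hγunit h)
    rw [hinv, mul_smul_comm, mul_one] at h1
    rw [← h1, smul_smul, Units.mul_inv, one_smul]
  have hV : LinearMap.trace ℂ V (π h) / LinearMap.trace ℂ V (π 1) = c := by
    rw [hπc, hπ1, map_smul, smul_eq_mul, mul_div_cancel_right₀]
    simp [Module.finrank_pos.ne']
  have hW : LinearMap.trace ℂ W (γ h) / LinearMap.trace ℂ W (γ 1) = c := by
    rw [hγd, hγ1, map_smul, smul_eq_mul, mul_div_cancel_right₀]
    simp [Module.finrank_pos.ne']
  refine ⟨⟨c, hπc⟩, ⟨c, hγd⟩, hV.trans hW.symm, ?_⟩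
  rw [hV]
  obtain ⟨b, hb, hk⟩ := exists_isOfFinOrder_smul_pow
    (fun g h => isOfFinOrder_iff_pow_eq_one.2 (hroot g h)) hπ1 hπmul h (orderOf h)
  rw [pow_orderOf_eq_one, hπ1, hπc, smul_pow, one_pow, smul_smul] at hk
  have hbc : b * c ^ orderOf h = 1 := by
    apply Units.ext
    push_cast
    obtain ⟨v, hv⟩ := exists_ne (0 : V)
    have hkv := LinearMap.congr_fun hk v
    simp only [LinearMap.smul_apply, Module.End.one_apply] at hkv
    exact smul_left_injective ℂ hv (by simpa using hkv.symm)
  have hc : IsOfFinOrder c := by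
    refine IsOfFinOrder.of_pow (n := orderOf h) ?_ (orderOf_pos h).ne'
    rw [← inv_eq_of_mul_eq_one_right hbc]
    exact hb.inv
  obtain ⟨n, hn, hcn⟩ := isOfFinOrder_iff_pow_eq_one.1 hc
  exact ⟨n, hn, by simpa using congrArg Units.val hcn⟩
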